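/- arXiv:1811.09252 — 3 statements merged into one kernel-verified Lean document; each statement's English description precedes it below -/
import Mathlib

section
/- Let q : (0,∞) → ℂ be measurable with ∫_0^∞ (1+x)|q(x)| dx < ∞. Then the series ψ(k) = 1 + ∑_{n≥1} y_n(0,k) converges uniformly on the closed upper half-plane {Im k ≥ 0}, and the Jost function ψ is analytic on the open upper half-plane ℂ₊ = {Im k > 0} and continuous on {Im k ≥ 0}. -/
open MeasureTheory Complex Filter Set

/-- The kernel `G(t,k) = (sin(kt)/k)·e^{ikt}` for `k ≠ 0`, with `G(t,0) = t`. -/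
noncomputable def G (t : ℝ) (k : ℂ) : ℂ :=
  if k = 0 then (t : ℂ) else Complex.sin (k * t) / k * Complex.exp (Complex.I * k * t)

/-- The previous node `t_{j-1}` of the simplex `x = t₀ < t₁ < ⋯ < t_n`. -/
noncomputable def prevNode (x : ℝ) {n : ℕ} (t : Fin n → ℝ) (j : Fin n) : ℝ :=
  if (j : ℕ) = 0 then x
  else t ⟨(j : ℕ) - 1, Nat.lt_of_le_of_lt (Nat.sub_le _ _) j.isLt⟩

/-- The iterated simplex integral
`y_n(x,k) = ∫_{x = t₀ < t₁ < ⋯ < t_n} ∏_{j=1}^n G(t_j − t_{j−1}, k)·q(t_j) dt₁⋯dt_n`. -/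
noncomputable def ysimp (q : ℝ → ℂ) (n : ℕ) (x : ℝ) (k : ℂ) : ℂ :=
  ∫ t : Fin n → ℝ in {t | StrictMono t ∧ ∀ i, x < t i},
    ∏ j, G (t j - prevNode x t j) k * q (t j)

/-- The Jost function `ψ(k) = 1 + ∑_{n ≥ 1} y_n(0,k)`. -/
noncomputable def jost (q : ℝ → ℂ) (k : ℂ) : ℂ :=
  1 + ∑' n : ℕ, ysimp q (n + 1) 0 k

lemma aux_norm_exp_sub_one {z : ℂ} (hz : z.re ≤ 0) : ‖Complex.exp z - 1‖ ≤ ‖z‖ := by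
  have h := Convex.norm_image_sub_le_of_norm_deriv_le (𝕜 := ℂ) (f := Complex.exp) (C := 1)
    (s := {w : ℂ | w.re ≤ 0}) (x := 0) (y := z)
    (fun x _ => Complex.differentiableAt_exp)
    (fun x hx => by
      rw [Complex.deriv_exp, Complex.norm_exp]
      exact Real.exp_le_one_iff.2 hx)
    (convex_halfSpace_re_le 0) (by simp) hz
  simpa using h

lemma aux_G_bound {t : ℝ} (ht : 0 ≤ t) {k : ℂ} (hk : 0 ≤ k.im) : ‖G t k‖ ≤ t := by
  unfold G
  split_ifs with h
  · simp [abs_of_nonneg ht]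
  · have h1 : Complex.sin (k * t) / k * Complex.exp (Complex.I * k * t)
        = (Complex.exp (2 * Complex.I * k * t) - 1) / (2 * Complex.I * k) := by
      have e1 : Complex.exp (2 * Complex.I * k * t)
          = Complex.exp (Complex.I * k * t) * Complex.exp (Complex.I * k * t) := by
        rw [← Complex.exp_add]; ring_nf
      have e2 : Complex.exp (-(k * t) * Complex.I) * Complex.exp (Complex.I * k * t) = 1 := by
        rw [← Complex.exp_add]; ring_nf; simp
      have e3 : Complex.exp ((k * t) * Complex.I) = Complex.exp (Complex.I * k * t) := by
        ring_nf
      rw [e1, Complex.sin, e3]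
      have hI : Complex.I ≠ 0 := Complex.I_ne_zero
      generalize Complex.exp (-(k * t) * Complex.I) = A at *
      generalize Complex.exp (Complex.I * k * t) = B at *
      field_simp
      rw [Complex.I_sq]
      linear_combination -e2
    have h2 : ‖Complex.exp (2 * Complex.I * k * t) - 1‖ ≤ ‖2 * Complex.I * k * t‖ := by
      apply aux_norm_exp_sub_one
      have : (2 * Complex.I * k * t).re = - (2 * (k.im * t)) := by simp; ring
      rw [this]
      have := mul_nonneg hk ht
      linarith
    have h3 : 0 < ‖2 * Complex.I * k‖ := by simp [h]
    rw [h1, norm_div, div_le_iff₀ h3]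
    refine h2.trans (le_of_eq ?_)
    rw [norm_mul _ (t : ℂ), Complex.norm_real, Real.norm_eq_abs, abs_of_nonneg ht, mul_comm]

lemma aux_G_diff (t : ℝ) : Differentiable ℂ (G t) := by
  have h0 : HasDerivAt (fun k : ℂ => Complex.sin (k * t)) (t : ℂ) 0 := by
    have := ((hasDerivAt_id (0 : ℂ)).mul_const (t : ℂ)).csin
    simpa using this
  have hG : G t = fun k => dslope (fun k : ℂ => Complex.sin (k * t)) 0 k *
      Complex.exp (Complex.I * k * t) := by
    funext k
    unfold G
    split_ifs with h
    · subst h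
      simp [dslope_same, h0.deriv]
    · rw [dslope_of_ne _ h, slope_def_field]
      simp
  rw [hG]
  apply Differentiable.mul
  · rw [← differentiableOn_univ, Complex.differentiableOn_dslope Filter.univ_mem]
    fun_prop
  · fun_prop

lemma aux_G_meas (k : ℂ) : Measurable (fun t : ℝ => G t k) := by
  unfold G
  split_ifs with h
  · fun_prop
  · fun_prop

lemma aux_prev_meas (x : ℝ) {n : ℕ} (j : Fin n) :
    Measurable (fun t : Fin n → ℝ => prevNode x t j) := by
  unfold prevNode
  split_ifs with h
  · fun_prop
  · fun_prop

lemma aux_integrand_meas {q : ℝ → ℂ} (hmq : Measurable q) (n : ℕ) (x : ℝ) (k : ℂ) :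
    Measurable (fun t : Fin n → ℝ => ∏ j, G (t j - prevNode x t j) k * q (t j)) := by
  refine Finset.measurable_prod _ fun j _ => ?_
  refine Measurable.mul ?_ (hmq.comp (measurable_pi_apply j))
  exact (aux_G_meas k).comp ((measurable_pi_apply j).sub (aux_prev_meas x j))

lemma aux_mono_meas (n : ℕ) : MeasurableSet {t : Fin n → ℝ | StrictMono t} := by
  simp only [StrictMono, ofPred_forall]
  refine MeasurableSet.iInter fun i => MeasurableSet.iInter fun j => MeasurableSet.iInter fun _ => ?_
  exact measurableSet_lt (measurable_pi_apply i) (measurable_pi_apply j)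

lemma aux_set_meas (n : ℕ) (x : ℝ) :
    MeasurableSet {t : Fin n → ℝ | StrictMono t ∧ ∀ i, x < t i} := by
  refine (aux_mono_meas n).inter ?_
  have : {t : Fin n → ℝ | ∀ i, x < t i} = ⋂ i, {t : Fin n → ℝ | x < t i} := by
    ext t; simp
  change MeasurableSet {t : Fin n → ℝ | ∀ i, x < t i}
  rw [this]
  exact MeasurableSet.iInter fun i => measurableSet_lt measurable_const (measurable_pi_apply i)

/-- Simplex bound by symmetrization. -/
lemma aux_simplex {f : ℝ → ℝ} (hf : Integrable f) (hf0 : ∀ t, 0 ≤ f t) (n : ℕ) :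
    ∫ t : Fin n → ℝ in {t | StrictMono t}, ∏ j, f (t j) ≤ (∫ t, f t) ^ n / n.factorial := by
  have hprodInt : Integrable (fun t : Fin n → ℝ => ∏ j, f (t j)) :=
    Integrable.fintype_prod (f := fun _ => f) (fun _ => hf)
  have hsum : ∫ t in ⋃ σ : Equiv.Perm (Fin n), {t : Fin n → ℝ | StrictMono (t ∘ σ)},
      ∏ j, f (t j) = ∑ σ : Equiv.Perm (Fin n),
        ∫ t in {t : Fin n → ℝ | StrictMono (t ∘ σ)}, ∏ j, f (t j) := by
    apply integral_iUnion_fintype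
    · intro σ
      have : Measurable (fun t : Fin n → ℝ => t ∘ σ) :=
        measurable_pi_lambda _ fun i => measurable_pi_apply (σ i)
      exact this (aux_mono_meas n)
    · intro σ τ hst
      rw [Function.onFun, Set.disjoint_left]
      intro t h1 h2
      apply hst
      have hr : Set.range (t ∘ σ) = Set.range (t ∘ τ) := by
        rw [Set.range_comp, Set.range_comp, σ.surjective.range_eq, τ.surjective.range_eq]
      have he := (StrictMono.range_inj h1 h2).1 hr
      have hinj : Function.Injective t := by
        have : t = (t ∘ σ) ∘ σ.symm := by funext i; simp
        rw [this]
        exact (StrictMono.injective h1).comp σ.symm.injective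
      ext i
      exact congrArg _ (hinj (congrFun he i))
    · intro σ
      exact hprodInt.integrableOn
  have heq : ∀ σ : Equiv.Perm (Fin n),
      ∫ t in {t : Fin n → ℝ | StrictMono (t ∘ σ)}, ∏ j, f (t j)
        = ∫ t : Fin n → ℝ in {t | StrictMono t}, ∏ j, f (t j) := by
    intro σ
    have hmp := volume_measurePreserving_piCongrLeft (fun _ : Fin n => ℝ) σ.symm
    have hval : ∀ t : Fin n → ℝ,
        MeasurableEquiv.piCongrLeft (fun _ : Fin n => ℝ) σ.symm t = t ∘ σ := by
      intro t
      funext i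
      have := Equiv.piCongrLeft_apply_apply (fun _ : Fin n => ℝ) σ.symm t (σ i)
      simpa [MeasurableEquiv.coe_piCongrLeft] using this
    have := hmp.setIntegral_preimage_emb (MeasurableEquiv.measurableEmbedding _)
      (fun t => ∏ j, f (t j)) {t | StrictMono t}
    rw [← this]
    simp only [Set.preimage, hval, Set.mem_ofPred_eq]
    refine integral_congr_ae (Eventually.of_forall fun t => ?_)
    simp only [Function.comp]
    exact (Equiv.prod_comp σ (fun j => f (t j))).symm
  have hle : ∫ t in ⋃ σ : Equiv.Perm (Fin n), {t : Fin n → ℝ | StrictMono (t ∘ σ)},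
      ∏ j, f (t j) ≤ ∫ t : Fin n → ℝ, ∏ j, f (t j) :=
    setIntegral_le_integral hprodInt
      (Eventually.of_forall fun t => Finset.prod_nonneg fun j _ => hf0 _)
  rw [hsum, integral_fintype_prod_volume_eq_pow] at hle
  simp only [heq, Finset.sum_const, Finset.card_univ, Fintype.card_perm, Fintype.card_fin,
    nsmul_eq_mul] at hle
  rw [le_div_iff₀ (by positivity), mul_comm]
  exact hle

/-- Holomorphic dependence of parametric integrals on an open set. -/
lemma aux_holo {α : Type*} [MeasurableSpace α] {μ : Measure α} {F : ℂ → α → ℂ} {b : α → ℝ}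
    {U : Set ℂ} (hU : IsOpen U) (hm : ∀ k, AEStronglyMeasurable (F k) μ)
    (hb : ∀ᵐ a ∂μ, ∀ k ∈ U, ‖F k a‖ ≤ b a) (hbi : Integrable b μ)
    (hd : ∀ a, Differentiable ℂ (fun k => F k a)) :
    DifferentiableOn ℂ (fun k => ∫ a, F k a ∂μ) U := by
  intro k hk
  obtain ⟨r, hr, hball⟩ := Metric.isOpen_iff.1 hU k hk
  have hr4 : 0 < r / 4 := by linarith
  have key := hasDerivAt_integral_of_dominated_loc_of_deriv_le (μ := μ) (F := F) (x₀ := k)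
    (s := Metric.ball k (r / 4)) (bound := fun a => b a / (r / 4))
    (F' := fun z a => deriv (fun k => F k a) z)
    (Metric.ball_mem_nhds k hr4) (Eventually.of_forall hm)
    (hbi.mono' (hm k) (hb.mono fun a ha => ha k hk))
    ?_ ?_ (hbi.div_const _) ?_
  · exact key.2.differentiableAt.differentiableWithinAt
  · have hseq : Tendsto (fun n : ℕ => (1 / ((n : ℂ) + 1))) atTop (nhdsWithin 0 {0}ᶜ) := by
      rw [tendsto_nhdsWithin_iff]
      refine ⟨tendsto_one_div_add_atTop_nhds_zero_nat, Eventually.of_forall fun n => ?_⟩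
      have : (n : ℂ) + 1 ≠ 0 := Nat.cast_add_one_ne_zero n
      simpa using this
    refine aestronglyMeasurable_of_tendsto_ae atTop
      (f := fun (n : ℕ) a => (1 / ((n : ℂ) + 1))⁻¹ • (F (k + 1 / ((n : ℂ) + 1)) a - F k a))
      (fun n => ((hm (k + 1 / ((n : ℂ) + 1))).sub (hm k)).const_smul
        ((1 / ((n : ℂ) + 1))⁻¹ : ℂ)) (Eventually.of_forall fun a => ?_)
    have := (hasDerivAt_iff_tendsto_slope_zero.1 (hd a k).hasDerivAt).comp hseq
    exact this
  · refine hb.mono fun a ha z hz => ?_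
    refine Complex.norm_deriv_le_of_forall_mem_sphere_norm_le hr4 (hd a).diffContOnCl ?_
    intro w hw
    apply ha w (hball _)
    rw [Metric.mem_ball] at hz ⊢
    rw [Metric.mem_sphere] at hw
    have := dist_triangle w z k
    linarith
  · exact Eventually.of_forall fun a z _ => (hd a z).hasDerivAt

lemma aux_f_int {q : ℝ → ℂ} (hmq : Measurable q)
    (hq : IntegrableOn (fun x => (1 + x) * ‖q x‖) (Set.Ioi 0)) :
    Integrable ((Set.Ioi (0 : ℝ)).indicator fun x => x * ‖q x‖) := by
  rw [integrable_indicator_iff measurableSet_Ioi]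
  refine Integrable.mono' hq (measurable_id.mul hmq.norm).aestronglyMeasurable ?_
  refine (ae_restrict_iff' measurableSet_Ioi).2 (Eventually.of_forall fun x hx => ?_)
  have hx' : 0 < x := hx
  rw [norm_mul, norm_norm, Real.norm_eq_abs, abs_of_pos hx']
  exact mul_le_mul_of_nonneg_right (by linarith) (norm_nonneg _)

lemma aux_pointwise (q : ℝ → ℂ) {n : ℕ} {t : Fin n → ℝ}
    (ht : t ∈ {t : Fin n → ℝ | StrictMono t ∧ ∀ i, 0 < t i}) {k : ℂ} (hk : 0 ≤ k.im) :
    ‖∏ j, G (t j - prevNode 0 t j) k * q (t j)‖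
      ≤ ∏ j, (Set.Ioi (0 : ℝ)).indicator (fun x => x * ‖q x‖) (t j) := by
  obtain ⟨hmono, hpos⟩ := ht
  rw [norm_prod]
  refine Finset.prod_le_prod (fun _ _ => norm_nonneg _) fun j _ => ?_
  rw [Set.indicator_of_mem (show t j ∈ Set.Ioi (0 : ℝ) from hpos j), norm_mul]
  refine mul_le_mul_of_nonneg_right ?_ (norm_nonneg _)
  have hp : 0 ≤ prevNode 0 t j ∧ prevNode 0 t j ≤ t j := by
    unfold prevNode
    split_ifs with h
    · exact ⟨le_rfl, (hpos j).le⟩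
    · refine ⟨(hpos _).le, hmono.monotone ?_⟩
      rw [Fin.le_def]
      exact Nat.sub_le _ _
  exact (aux_G_bound (by linarith [hp.2]) hk).trans (by linarith [hp.1])

/-- If `q` is measurable with `∫_0^∞ (1+x)|q(x)| dx < ∞`, then the series
`ψ(k) = 1 + ∑_{n≥1} y_n(0,k)` converges uniformly on the closed upper half-plane,
and the Jost function `ψ` is analytic on the open upper half-plane and continuous
on the closed upper half-plane. -/
theorem jost_analytic (q : ℝ → ℂ) (hmq : Measurable q)
    (hq : IntegrableOn (fun x => (1 + x) * ‖q x‖) (Set.Ioi 0)) :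
    TendstoUniformlyOn (fun N k => 1 + ∑ n ∈ Finset.range N, ysimp q (n + 1) 0 k)
        (jost q) atTop {k : ℂ | 0 ≤ k.im} ∧
      AnalyticOnNhd ℂ (jost q) {k : ℂ | 0 < k.im} ∧
      ContinuousOn (jost q) {k : ℂ | 0 ≤ k.im} := by
  set f : ℝ → ℝ := (Set.Ioi (0 : ℝ)).indicator fun x => x * ‖q x‖ with hfdef
  have hf : Integrable f := aux_f_int hmq hq
  have hf0 : ∀ t, 0 ≤ f t := fun t =>
    Set.indicator_nonneg (fun x hx => mul_nonneg (le_of_lt hx) (norm_nonneg _)) t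
  have hprodInt : ∀ n : ℕ, Integrable (fun t : Fin n → ℝ => ∏ j, f (t j)) := fun n =>
    Integrable.fintype_prod (f := fun _ => f) (fun _ => hf)
  have hae : ∀ n : ℕ, ∀ᵐ t : Fin n → ℝ ∂(volume.restrict
      {t : Fin n → ℝ | StrictMono t ∧ ∀ i, 0 < t i}), ∀ k ∈ {k : ℂ | 0 ≤ k.im},
      ‖∏ j, G (t j - prevNode 0 t j) k * q (t j)‖ ≤ ∏ j, f (t j) := fun n =>
    (ae_restrict_iff' (aux_set_meas n 0)).2
      (Eventually.of_forall fun t ht k hk => aux_pointwise q ht hk)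
  have hdiff : ∀ (n : ℕ) (t : Fin n → ℝ),
      Differentiable ℂ (fun k => ∏ j, G (t j - prevNode 0 t j) k * q (t j)) := fun n t =>
    Differentiable.fun_finsetProd fun j _ => (aux_G_diff _).mul_const _
  have hbound : ∀ (n : ℕ) (k : ℂ), k ∈ {k : ℂ | 0 ≤ k.im} →
      ‖ysimp q n 0 k‖ ≤ (∫ t, f t) ^ n / n.factorial := by
    intro n k hk
    refine (norm_integral_le_of_norm_le (hprodInt n).integrableOn
      ((hae n).mono fun t ht => ht k hk)).trans ?_
    refine le_trans ?_ (aux_simplex hf hf0 n)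
    exact setIntegral_mono_set (hprodInt n).integrableOn
      (Eventually.of_forall fun t => Finset.prod_nonneg fun j _ => hf0 _)
      (Eventually.of_forall fun t ht => ht.1)
  have hsum : Summable (fun n : ℕ => (∫ t, f t) ^ (n + 1) / (n + 1).factorial) :=
    (summable_nat_add_iff 1).2 (Real.summable_pow_div_factorial (∫ t, f t))
  have hunif : TendstoUniformlyOn (fun N k => 1 + ∑ n ∈ Finset.range N, ysimp q (n + 1) 0 k)
        (jost q) atTop {k : ℂ | 0 ≤ k.im} := by
    have h := tendstoUniformlyOn_tsum_nat hsum
      (f := fun n k => ysimp q (n + 1) 0 k) (s := {k : ℂ | 0 ≤ k.im})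
      (fun n k hk => hbound (n + 1) k hk)
    rw [Metric.tendstoUniformlyOn_iff] at h ⊢
    intro ε hε
    filter_upwards [h ε hε] with N hN k hk
    simpa [jost] using hN k hk
  refine ⟨hunif, ?_, ?_⟩
  · have hopen : IsOpen {k : ℂ | 0 < k.im} := isOpen_lt continuous_const Complex.continuous_im
    have hsub : {k : ℂ | 0 < k.im} ⊆ {k : ℂ | 0 ≤ k.im} := fun k (hk : 0 < k.im) => hk.le
    refine DifferentiableOn.analyticOnNhd ?_ hopen
    refine DifferentiableOn.const_add (𝕜 := ℂ) (f := fun k => ∑' n : ℕ, ysimp q (n + 1) 0 k) 1 ?_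
    refine Complex.differentiableOn_tsum_of_summable_norm hsum (fun n => ?_) hopen
      (fun n k hk => hbound (n + 1) k (hsub hk))
    exact aux_holo hopen (fun k => (aux_integrand_meas hmq _ _ _).aestronglyMeasurable)
      ((hae (n + 1)).mono fun t ht k hk => ht k (hsub hk)) (hprodInt (n + 1)).integrableOn
      (hdiff (n + 1))
  · refine hunif.continuousOn (Eventually.of_forall fun N => ?_).frequently
    refine continuousOn_const.add (continuousOn_finsetSum _ fun n _ => ?_)
    exact continuousOn_of_dominated
      (fun k _ => (aux_integrand_meas hmq _ _ _).aestronglyMeasurable)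
      (fun k hk => (hae (n + 1)).mono fun t ht => ht k hk) (hprodInt (n + 1)).integrableOn
      (Eventually.of_forall fun t => (hdiff (n + 1) t).continuous.continuousOn)
end

section
/- Let q : (0,∞) → ℂ be measurable with ∫_0^∞ (1+x)|q(x)| dx < ∞, and let k ∈ ℂ with Im k ≥ 0. If ω = ‖q‖₁, or if k ≠ 0 and ω = ‖q‖/|k|, then the Jost function satisfies |ψ(k)| ≤ e^ω, |ψ(k) − 1| ≤ ω·e^ω, and |ψ(k) − 1 − ψ₁(k)| ≤ (ω²/2)·e^ω. -/
open MeasureTheory Complex Filter Set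

theorem norm_exp_sub_one_le_of_re (w : ℂ) (hw : w.re ≤ 0) : ‖Complex.exp w - 1‖ ≤ ‖w‖ := by
  have h := (convex_halfSpace_re_le 0).norm_image_sub_le_of_norm_deriv_le (𝕜 := ℂ)
    (f := Complex.exp) (C := 1) (x := 0) (y := w)
    (fun x _ => Complex.differentiable_exp x)
    (fun x hx => by
      rw [Complex.deriv_exp, Complex.norm_exp]
      exact Real.exp_le_one_iff.2 hx) (by simp) hw
  simpa using h

theorem G_formula (t : ℝ) (k : ℂ) (hk : k ≠ 0) :
    G t k = (Complex.exp (2 * Complex.I * k * t) - 1) / (2 * Complex.I * k) := by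
  have hI := Complex.I_ne_zero
  have h1 : Complex.exp (2 * Complex.I * k * t)
      = Complex.exp (Complex.I * k * t) * Complex.exp (Complex.I * k * t) := by
    rw [← Complex.exp_add]; ring_nf
  have h2 : Complex.exp (-(k * t) * Complex.I) * Complex.exp (Complex.I * k * t) = 1 := by
    rw [← Complex.exp_add]; ring_nf; simp
  have h3 : Complex.exp (k * t * Complex.I) = Complex.exp (Complex.I * k * t) := by
    congr 1; ring
  rw [G, if_neg hk, Complex.sin, h1, h3]
  rw [div_mul_eq_mul_div, div_eq_div_iff hk (by simp [hk])]
  linear_combination (Complex.I ^ 2 * k) * h2 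
    + k * (1 - Complex.exp (Complex.I * k * t) * Complex.exp (Complex.I * k * t)) * (Complex.I_sq)
    

theorem re_aux (t : ℝ) (ht : 0 ≤ t) (k : ℂ) (hk : 0 ≤ k.im) :
    (2 * Complex.I * k * t).re ≤ 0 := by
  simp
  positivity

theorem norm_G_le (t : ℝ) (ht : 0 ≤ t) (k : ℂ) (hk : 0 ≤ k.im) : ‖G t k‖ ≤ t := by
  by_cases h0 : k = 0
  · simp [G, h0, abs_of_nonneg ht]
  · rw [G_formula t k h0, norm_div]
    have := norm_exp_sub_one_le_of_re _ (re_aux t ht k hk)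
    have hp : 0 < ‖2 * Complex.I * k‖ := by simp [h0]
    rw [div_le_iff₀ hp]
    rw [norm_mul _ (t : ℂ), Complex.norm_of_nonneg ht] at this
    linarith

theorem norm_G_le' (t : ℝ) (ht : 0 ≤ t) (k : ℂ) (hk : 0 ≤ k.im) (h0 : k ≠ 0) :
    ‖G t k‖ ≤ 1 / ‖k‖ := by
  rw [G_formula t k h0, norm_div]
  have h1 : ‖Complex.exp (2 * Complex.I * k * t) - 1‖ ≤ 2 := by
    refine (norm_sub_le _ _).trans ?_
    have : ‖Complex.exp (2 * Complex.I * k * t)‖ ≤ 1 := by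
      rw [Complex.norm_exp]
      exact Real.exp_le_one_iff.2 (re_aux t ht k hk)
    simp only [norm_one]; linarith
  have hp : 0 < ‖k‖ := by simpa using h0
  have : ‖2 * Complex.I * k‖ = 2 * ‖k‖ := by simp
  rw [this, div_le_div_iff₀ (by positivity) hp]
  nlinarith

theorem simplex_le (f : ℝ → ℝ) (hf0 : ∀ x, 0 ≤ f x) (hf : Integrable f) (n : ℕ) :
    ∫ t : Fin n → ℝ in {t | StrictMono t}, ∏ j, f (t j) ≤ (∫ x, f x) ^ n / (n.factorial : ℝ) := by
  have hint : Integrable (fun t : Fin n → ℝ => ∏ j, f (t j)) :=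
    Integrable.fintype_prod (f := fun _ => f) (μ := fun _ => volume) (fun _ => hf)
  let S : Equiv.Perm (Fin n) → Set (Fin n → ℝ) := fun σ => {t | StrictMono (t ∘ σ)}
  have hS : ∀ σ, MeasurableSet (S σ) := by
    intro σ
    have : S σ = ⋂ i, ⋂ j, ⋂ (_ : i < j), {t : Fin n → ℝ | t (σ i) < t (σ j)} := by
      ext t
      simp [S, StrictMono]
    rw [this]
    refine MeasurableSet.iInter fun i => MeasurableSet.iInter fun j => MeasurableSet.iInter fun _ => ?_
    exact measurableSet_lt (measurable_pi_apply _) (measurable_pi_apply _)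
  have hdis : Pairwise (Function.onFun Disjoint S) := by
    intro σ τ hne
    rw [Function.onFun, Set.disjoint_left]
    intro t h1 h2
    apply hne
    have h3 : t ∘ σ = t ∘ τ := by
      apply (StrictMono.range_inj h1 h2).1
      rw [σ.surjective.range_comp, τ.surjective.range_comp]
    have hinj : Function.Injective t := by
      have := h1.injective
      exact (Function.Injective.of_comp_iff' t σ.bijective).1 this
    ext i
    exact congrArg Fin.val (hinj (congrFun h3 i))
  have heq : ∀ σ, ∫ t in S σ, ∏ j, f (t j) = ∫ t : Fin n → ℝ in {t | StrictMono t}, ∏ j, f (t j) := by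
    intro σ
    have hmp := volume_measurePreserving_piCongrLeft (fun _ : Fin n => ℝ) σ
    rw [← hmp.setIntegral_preimage_emb (MeasurableEquiv.measurableEmbedding _)]
    have happ : ∀ (t : Fin n → ℝ) (i : Fin n),
        (MeasurableEquiv.piCongrLeft (fun _ : Fin n => ℝ) σ) t (σ i) = t i := fun t i =>
      MeasurableEquiv.piCongrLeft_apply_apply σ (β := fun _ => ℝ) t i
    congr 1
    · congr 1
      ext t
      simp only [S, Set.mem_preimage, Set.mem_ofPred_eq]
      have : ((MeasurableEquiv.piCongrLeft (fun _ : Fin n => ℝ) σ) t) ∘ σ = t := by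
        ext i; exact happ t i
      rw [this]
    · ext t
      rw [← Equiv.prod_comp σ]
      exact Finset.prod_congr rfl fun i _ => by rw [happ]
  have hsum := integral_iUnion_fintype (μ := volume) hS hdis (fun σ => hint.integrableOn (s := S σ))
  have hle : ∫ t in ⋃ σ, S σ, ∏ j, f (t j) ≤ ∫ t : Fin n → ℝ, ∏ j, f (t j) :=
    setIntegral_le_integral hint (Eventually.of_forall fun t => Finset.prod_nonneg fun j _ => hf0 _)
  rw [hsum, integral_fintype_prod_volume_eq_pow] at hle
  simp only [heq, Finset.sum_const, Finset.card_univ, Fintype.card_perm, Fintype.card_fin,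
    nsmul_eq_mul] at hle
  rw [le_div_iff₀ (by positivity)]
  linarith

theorem ysimp_le (q : ℝ → ℂ) (k : ℂ) (f : ℝ → ℝ) (hf0 : ∀ x, 0 ≤ f x) (hf : Integrable f)
    (hG : ∀ s t, 0 ≤ s → s < t → ‖G (t - s) k * q t‖ ≤ f t) (n : ℕ) :
    ‖ysimp q n 0 k‖ ≤ (∫ x, f x) ^ n / (n.factorial : ℝ) := by
  have hint : Integrable (fun t : Fin n → ℝ => ∏ j, f (t j)) :=
    Integrable.fintype_prod (f := fun _ => f) (μ := fun _ => volume) (fun _ => hf)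
  refine le_trans ?_ (simplex_le f hf0 hf n)
  have hm : MeasurableSet {t : Fin n → ℝ | StrictMono t ∧ ∀ i, 0 < t i} := by
    have : {t : Fin n → ℝ | StrictMono t ∧ ∀ i, 0 < t i} =
        (⋂ i, ⋂ j, ⋂ (_ : i < j), {t : Fin n → ℝ | t i < t j}) ∩ ⋂ i, {t : Fin n → ℝ | 0 < t i} := by
      ext t
      simp [StrictMono]
    rw [this]
    refine MeasurableSet.inter (MeasurableSet.iInter fun i => MeasurableSet.iInter fun j =>
      MeasurableSet.iInter fun _ => ?_) (MeasurableSet.iInter fun i => ?_)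
    · exact measurableSet_lt (measurable_pi_apply _) (measurable_pi_apply _)
    · exact measurableSet_lt measurable_const (measurable_pi_apply _)
  have h1 : ‖ysimp q n 0 k‖ ≤
      ∫ t : Fin n → ℝ in {t | StrictMono t ∧ ∀ i, 0 < t i}, ∏ j, f (t j) := by
    refine norm_integral_le_of_norm_le hint.integrableOn ?_
    refine (ae_restrict_iff' hm).2 (Eventually.of_forall fun t ht => ?_)
    rw [norm_prod]
    refine Finset.prod_le_prod (fun _ _ => norm_nonneg _) fun j _ => ?_
    unfold prevNode
    split_ifs with hj
    · exact hG _ _ le_rfl (ht.2 j)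
    · refine hG _ _ (ht.2 _).le (ht.1 ?_)
      rw [Fin.lt_def]
      simp only
      omega
  refine h1.trans (setIntegral_mono_set hint.integrableOn
    (Eventually.of_forall fun t => Finset.prod_nonneg fun j _ => hf0 _) ?_)
  exact Eventually.of_forall fun t ht => ht.1

theorem ysimp_one (q : ℝ → ℂ) (k : ℂ) :
    ysimp q 1 0 k = ∫ t in Set.Ioi (0:ℝ), G t k * q t := by
  have hmp := volume_preserving_funUnique (Fin 1) ℝ
  rw [← hmp.setIntegral_preimage_emb (MeasurableEquiv.measurableEmbedding _), ysimp]
  congr 1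
  · congr 1
    ext t
    simp [Subsingleton.strictMono]
  · ext t
    simp [prevNode]

theorem final_bounds (y : ℕ → ℂ) (ω : ℝ) (h0 : 0 ≤ ω)
    (hy : ∀ n, ‖y n‖ ≤ ω ^ n / (n.factorial : ℝ)) :
    ‖1 + ∑' n, y (n + 1)‖ ≤ Real.exp ω ∧ ‖1 + ∑' n, y (n + 1) - 1‖ ≤ ω * Real.exp ω ∧
    ‖1 + ∑' n, y (n + 1) - 1 - y 1‖ ≤ ω ^ 2 / 2 * Real.exp ω := by
  have hs : HasSum (fun n : ℕ => ω ^ n / (n.factorial : ℝ)) (Real.exp ω) := by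
    rw [Real.exp_eq_exp_ℝ]
    exact NormedSpace.expSeries_div_hasSum_exp ω
  have hs1 : HasSum (fun n : ℕ => ω ^ (n + 1) / ((n + 1).factorial : ℝ)) (Real.exp ω - 1) := by
    have := (hasSum_nat_add_iff' 1).2 hs
    simpa using this
  have hsy : Summable (fun n => y (n + 1)) :=
    Summable.of_norm_bounded hs1.summable fun n => hy (n + 1)
  have ha : ‖∑' n, y (n + 1)‖ ≤ Real.exp ω - 1 :=
    tsum_of_norm_bounded hs1 fun n => hy (n + 1)
  refine ⟨?_, ?_, ?_⟩
  · refine (norm_add_le _ _).trans ?_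
    simp only [norm_one]; linarith
  · rw [add_sub_cancel_left]
    refine tsum_of_norm_bounded (hs.mul_left ω) fun n => (hy (n + 1)).trans ?_
    rw [pow_succ', mul_div_assoc]
    gcongr
    simp
  · rw [add_sub_cancel_left, hsy.tsum_eq_zero_add, zero_add, add_sub_cancel_left]
    refine tsum_of_norm_bounded (hs.mul_left (ω ^ 2 / 2)) fun n => (hy (n + 1 + 1)).trans ?_
    rw [div_mul_div_comm, ← pow_add, show 2 + n = n + 1 + 1 by ring]
    gcongr
    rw [Nat.factorial_succ, Nat.factorial_succ]
    push_cast
    have h1 : (0:ℝ) < n.factorial := by positivity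
    have h2 : (0:ℝ) ≤ n := by positivity
    nlinarith [mul_nonneg h2 h1.le, mul_nonneg h2 (mul_nonneg h2 h1.le)]

/-- If `q` is measurable with `∫_0^∞ (1+x)|q(x)| dx < ∞`, and `k` is in the closed upper
half-plane, then with `ω = ‖q‖₁`, or with `ω = ‖q‖/|k|` when `k ≠ 0`, the Jost function
satisfies `|ψ(k)| ≤ e^ω`, `|ψ(k) − 1| ≤ ω·e^ω` and `|ψ(k) − 1 − ψ₁(k)| ≤ (ω²/2)·e^ω`,
where `ψ₁(k) = ∫_0^∞ G(t,k)·q(t) dt`. -/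
theorem jost_bounds (q : ℝ → ℂ) (hmq : Measurable q)
    (hq : IntegrableOn (fun x => (1 + x) * ‖q x‖) (Set.Ioi 0))
    (k : ℂ) (hk : 0 ≤ k.im) (ω : ℝ)
    (hω : ω = ∫ x in Set.Ioi (0:ℝ), x * ‖q x‖ ∨
          (k ≠ 0 ∧ ω = (∫ x in Set.Ioi (0:ℝ), ‖q x‖) / ‖k‖)) :
    ‖jost q k‖ ≤ Real.exp ω ∧
      ‖jost q k - 1‖ ≤ ω * Real.exp ω ∧
      ‖jost q k - 1 - ∫ t in Set.Ioi (0:ℝ), G t k * q t‖ ≤ ω ^ 2 / 2 * Real.exp ω := by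
  suffices h : ∃ g : ℝ → ℝ, (∀ x, 0 < x → 0 ≤ g x) ∧ IntegrableOn g (Set.Ioi 0) ∧
      (ω = ∫ x in Set.Ioi (0:ℝ), g x) ∧
      ∀ s t, 0 ≤ s → s < t → ‖G (t - s) k * q t‖ ≤ g t by
    obtain ⟨g, hg0, hgi, hgω, hG⟩ := h
    have hf0 : ∀ x, 0 ≤ (Set.Ioi (0:ℝ)).indicator g x := fun x =>
      Set.indicator_nonneg (fun x hx => hg0 x hx) x
    have hfω : ω = ∫ x, (Set.Ioi (0:ℝ)).indicator g x := by
      rw [integral_indicator measurableSet_Ioi, hgω]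
    have hy := ysimp_le q k _ hf0 ((integrable_indicator_iff measurableSet_Ioi).2 hgi)
      (fun s t hs hst => by
        rw [Set.indicator_of_mem (show t ∈ Set.Ioi (0:ℝ) from hs.trans_lt hst)]
        exact hG s t hs hst)
    rw [← hfω] at hy
    have h0 : 0 ≤ ω := by rw [hfω]; exact integral_nonneg hf0
    rw [← ysimp_one]
    exact final_bounds (fun n => ysimp q n 0 k) ω h0 hy
  rcases hω with hω | ⟨hk0, hω⟩
  · refine ⟨fun x => x * ‖q x‖, fun x hx => by positivity, ?_, hω, ?_⟩
    · refine Integrable.mono' hq (by fun_prop) ?_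
      refine (ae_restrict_iff' measurableSet_Ioi).2 (Eventually.of_forall fun x hx => ?_)
      have hx' : 0 < x := hx
      rw [Real.norm_of_nonneg (by positivity)]
      nlinarith [norm_nonneg (q x)]
    · intro s t hs hst
      rw [norm_mul]
      have := norm_G_le (t - s) (by linarith) k hk
      exact mul_le_mul_of_nonneg_right (by linarith) (norm_nonneg _)
  · refine ⟨fun x => ‖q x‖ / ‖k‖, fun x hx => by positivity, ?_, ?_, ?_⟩
    · refine Integrable.div_const ?_ _
      refine Integrable.mono' hq (by fun_prop) ?_
      refine (ae_restrict_iff' measurableSet_Ioi).2 (Eventually.of_forall fun x hx => ?_)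
      have hx' : 0 < x := hx
      rw [Real.norm_of_nonneg (by positivity)]
      nlinarith [norm_nonneg (q x), mul_nonneg hx'.le (norm_nonneg (q x))]
    · rw [hω, integral_div]
    · intro s t hs hst
      rw [norm_mul]
      have := norm_G_le' (t - s) (by linarith) k hk hk0
      calc _ ≤ 1 / ‖k‖ * ‖q t‖ := by gcongr
        _ = _ := by ring
end

section
/- Let q : (0,∞) → ℂ be measurable with ∫_0^∞ (1+x)|q(x)| dx < ∞, and let ω* ∈ (0,1) be the unique positive solution of ω*·e^{ω*} = 1. If k ∈ ℂ satisfies Im k ≥ 0, k ≠ 0 and ψ(k) = 0, then |k| ≤ ‖q‖/ω*; i.e. all zeros of the Jost function in the closed upper half-plane lie in the disk of radius ‖q‖/ω* centered at 0. -/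
open MeasureTheory Complex Filter Set

lemma G_norm_le (t : ℝ) (ht : 0 ≤ t) (k : ℂ) (hk : 0 ≤ k.im) (hk0 : k ≠ 0) :
    ‖G t k‖ ≤ 1 / ‖k‖ := by
  have hkp : 0 < ‖k‖ := norm_pos_iff.mpr hk0
  have h1 : Complex.sin (k * t) * Complex.exp (Complex.I * k * t)
      = (1 - Complex.exp (2 * (Complex.I * k * t))) * Complex.I / 2 := by
    have e1 : Complex.exp (2 * (Complex.I * k * t))
        = Complex.exp (Complex.I * k * t) * Complex.exp (Complex.I * k * t) := by
      rw [← Complex.exp_add]; ring_nf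
    have e2 : Complex.exp (-(Complex.I * k * t)) * Complex.exp (Complex.I * k * t) = 1 := by
      rw [← Complex.exp_add]; simp
    rw [Complex.sin, e1]
    have a1 : -(k * (t : ℂ)) * Complex.I = -(Complex.I * k * t) := by ring
    have a2 : (k * (t : ℂ)) * Complex.I = (Complex.I * k * t) := by ring
    rw [a1, a2]
    linear_combination (Complex.I / 2) * e2
  have h2 : ‖Complex.exp (2 * (Complex.I * k * t))‖ ≤ 1 := by
    rw [Complex.norm_exp]
    apply Real.exp_le_one_iff.mpr
    simp
    positivity
  have h3 : ‖Complex.sin (k * t) * Complex.exp (Complex.I * k * t)‖ ≤ 1 := by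
    rw [h1]
    simp only [norm_div, norm_mul, Complex.norm_I, mul_one, Complex.norm_two]
    have := norm_sub_le 1 (Complex.exp (2 * (Complex.I * k * t)))
    rw [norm_one] at this
    linarith
  have h4 : G t k = Complex.sin (k * t) * Complex.exp (Complex.I * k * t) / k := by
    rw [G, if_neg hk0]; ring
  rw [h4, norm_div]
  gcongr

lemma measurableSet_strictMono_pi (n : ℕ) (σ : Equiv.Perm (Fin n)) :
    MeasurableSet {t : Fin n → ℝ | StrictMono (t ∘ σ)} := by
  have : {t : Fin n → ℝ | StrictMono (t ∘ σ)}
      = ⋂ i, ⋂ j, ⋂ (_ : i < j), {t : Fin n → ℝ | t (σ i) < t (σ j)} := by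
    ext t
    simp only [mem_setOf_eq, mem_iInter]
    exact ⟨fun h i j hij => h hij, fun h i j hij => h i j hij⟩
  rw [this]
  refine MeasurableSet.iInter fun i => MeasurableSet.iInter fun j => MeasurableSet.iInter fun _ => ?_
  exact measurableSet_lt (measurable_pi_apply _) (measurable_pi_apply _)

lemma simplex_integral_le (g : ℝ → ℝ) (hg : Integrable g) (hg0 : ∀ x, 0 ≤ g x) (n : ℕ) :
    ∫ t : Fin n → ℝ in {t | StrictMono t}, ∏ j, g (t j) ≤ (∫ x, g x) ^ n / (n.factorial : ℝ) := by
  set F : (Fin n → ℝ) → ℝ := fun t => ∏ j, g (t j) with hF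
  have hFi : Integrable F := Integrable.fintype_prod (f := fun _ => g) (fun _ => hg)
  have hF0 : ∀ t, 0 ≤ F t := fun t => Finset.prod_nonneg fun j _ => hg0 _
  have hFint : ∫ t, F t = (∫ x, g x) ^ n := by
    rw [hF]
    have := integral_fintype_prod_volume_eq_pow (ι := Fin n) g
    simpa using this
  have hsym : ∀ σ : Equiv.Perm (Fin n),
      ∫ t in {t : Fin n → ℝ | StrictMono (t ∘ σ)}, F t = ∫ t in {t | StrictMono t}, F t := by
    intro σ
    have mp := (volume_preserving_arrowCongr' (σ.symm) (MeasurableEquiv.refl ℝ)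
      (MeasurePreserving.id volume))
    have := mp.setIntegral_preimage_emb (MeasurableEquiv.measurableEmbedding _) F {t | StrictMono t}
    rw [← this]
    have hcomp : ∀ t : Fin n → ℝ,
       (MeasurableEquiv.arrowCongr' (σ.symm) (MeasurableEquiv.refl ℝ)) t = t ∘ σ := by
      intro t; rfl
    have hFc : ∀ t : Fin n → ℝ, F (t ∘ σ) = F t := by
      intro t
      exact Equiv.prod_comp σ (fun j => g (t j))
    simp only [hcomp, hFc]
    rfl
  have hdisj : Pairwise (Function.onFun Disjoint
      (fun σ : Equiv.Perm (Fin n) => {t : Fin n → ℝ | StrictMono (t ∘ σ)})) := by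
    intro σ τ hst
    rw [Function.onFun, Set.disjoint_left]
    intro t h1 h2
    apply hst
    have h1' : StrictMono (t ∘ σ) := h1
    have h2' : StrictMono (t ∘ τ) := h2
    have hinj : Function.Injective t := by
      have := h1'.injective
      intro a b hab
      have := @this (σ.symm a) (σ.symm b) (by simpa using hab)
      simpa using this
    have hr : Set.range (t ∘ σ) = Set.range (t ∘ τ) := by
      rw [σ.surjective.range_comp, τ.surjective.range_comp]
    have := (h1'.range_inj h2').mp hr
    ext1 i
    exact hinj (congrFun this i)
  have hU := integral_iUnion_fintype (μ := volume) (f := F)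
    (fun σ => measurableSet_strictMono_pi n σ) hdisj (fun σ => hFi.integrableOn)
  simp only [hsym, Finset.sum_const, Finset.card_univ, Fintype.card_perm, Fintype.card_fin,
    nsmul_eq_mul] at hU
  have hle := setIntegral_le_integral (s := ⋃ σ : Equiv.Perm (Fin n), {t : Fin n → ℝ | StrictMono (t ∘ σ)}) hFi (Eventually.of_forall hF0)
  rw [hU, hFint] at hle
  rw [le_div_iff₀ (by positivity)]
  linarith

lemma ysimp_norm_le (q : ℝ → ℂ) (hq : IntegrableOn (fun x => ‖q x‖) (Set.Ioi 0))
    (k : ℂ) (hk : 0 ≤ k.im) (hk0 : k ≠ 0) (n : ℕ) :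
    ‖ysimp q n 0 k‖ ≤ ((∫ x in Set.Ioi (0:ℝ), ‖q x‖) / ‖k‖) ^ n / (n.factorial : ℝ) := by
  set g : ℝ → ℝ := (Set.Ioi (0:ℝ)).indicator (fun x => ‖q x‖) with hg
  have hgi : Integrable g := hq.integrable_indicator measurableSet_Ioi
  have hg0 : ∀ x, 0 ≤ g x := fun x => Set.indicator_nonneg (fun _ _ => norm_nonneg _) x
  have hgI : ∫ x, g x = ∫ x in Set.Ioi (0:ℝ), ‖q x‖ := integral_indicator measurableSet_Ioi
  have hFi : Integrable (fun t : Fin n → ℝ => ∏ j, g (t j)) :=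
    Integrable.fintype_prod (f := fun _ => g) (fun _ => hgi)
  have hF0 : ∀ t : Fin n → ℝ, 0 ≤ ∏ j, g (t j) := fun t => Finset.prod_nonneg fun j _ => hg0 _
  have hm0 : MeasurableSet {t : Fin n → ℝ | StrictMono t} := measurableSet_strictMono_pi n 1
  have hD : MeasurableSet {t : Fin n → ℝ | StrictMono t ∧ ∀ i, 0 < t i} := by
    have : MeasurableSet {t : Fin n → ℝ | ∀ i, 0 < t i} := by
      rw [Set.setOf_forall]
      exact MeasurableSet.iInter fun i => measurableSet_lt measurable_const (measurable_pi_apply _)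
    exact hm0.inter this
  have key : ‖ysimp q n 0 k‖ ≤ ∫ t : Fin n → ℝ in {t | StrictMono t ∧ ∀ i, 0 < t i},
      (1 / ‖k‖) ^ n * ∏ j, g (t j) := by
    rw [ysimp]
    apply norm_integral_le_of_norm_le (hFi.const_mul _).integrableOn
    refine (ae_restrict_iff' hD).mpr (Eventually.of_forall ?_)
    rintro t ⟨hmono, hpos⟩
    rw [norm_prod]
    calc ∏ j, ‖G (t j - prevNode 0 t j) k * q (t j)‖ ≤ ∏ j, (1 / ‖k‖ * g (t j)) := by
          apply Finset.prod_le_prod (fun _ _ => norm_nonneg _)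
          intro j _
          rw [norm_mul, hg, Set.indicator_of_mem (show t j ∈ Set.Ioi (0:ℝ) from hpos j)]
          gcongr
          apply G_norm_le _ _ _ hk hk0
          rw [prevNode]
          split_ifs with h
          · simpa using (hpos j).le
          · rw [sub_nonneg]
            apply hmono.monotone
            rw [Fin.le_def]
            exact Nat.sub_le _ _
      _ = _ := by simp [Finset.prod_mul_distrib]
  refine key.trans ?_
  rw [integral_const_mul]
  have h1 : ∫ t : Fin n → ℝ in {t | StrictMono t ∧ ∀ i, 0 < t i}, ∏ j, g (t j)
      ≤ ∫ t : Fin n → ℝ in {t | StrictMono t}, ∏ j, g (t j) :=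
    setIntegral_mono_set hFi.integrableOn (Eventually.of_forall hF0)
      (Eventually.of_forall (fun t ht => ht.1))
  have h2 := simplex_integral_le g hgi hg0 n
  rw [hgI] at h2
  calc _ ≤ (1 / ‖k‖) ^ n * ((∫ x in Set.Ioi (0:ℝ), ‖q x‖) ^ n / (n.factorial : ℝ)) := by
        gcongr
        exact h1.trans h2
    _ = _ := by rw [div_pow, div_pow]; ring

/-- Let `ω* ∈ (0,1)` be the positive solution of `ω*·e^{ω*} = 1`. If `q` is measurable with
`∫_0^∞ (1+x)|q(x)| dx < ∞` and `k ≠ 0` is in the closed upper half-plane with `ψ(k) = 0`,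
then `|k| ≤ ‖q‖/ω*`. -/
theorem jost_zeros_bounded (q : ℝ → ℂ) (hmq : Measurable q)
    (hq : IntegrableOn (fun x => (1 + x) * ‖q x‖) (Set.Ioi 0))
    (ω : ℝ) (hω0 : 0 < ω) (hω1 : ω < 1) (hωe : ω * Real.exp ω = 1)
    (k : ℂ) (hk : 0 ≤ k.im) (hk0 : k ≠ 0) (hzero : jost q k = 0) :
    ‖k‖ ≤ (∫ x in Set.Ioi (0:ℝ), ‖q x‖) / ω := by
  have hkp : 0 < ‖k‖ := norm_pos_iff.mpr hk0
  have hqi : IntegrableOn (fun x => ‖q x‖) (Set.Ioi 0) := by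
    refine Integrable.mono' hq hmq.norm.aestronglyMeasurable ?_
    refine (ae_restrict_iff' measurableSet_Ioi).mpr (Eventually.of_forall ?_)
    intro x hx
    have hx' : 0 < x := hx
    rw [norm_norm]
    nlinarith [norm_nonneg (q x)]
  by_contra! hcon
  set Q := ∫ x in Set.Ioi (0:ℝ), ‖q x‖ with hQ
  have ha : Q / ‖k‖ < ω := by
    rw [div_lt_iff₀ hω0] at hcon
    rw [div_lt_iff₀ hkp]
    linarith
  have hs : HasSum (fun n : ℕ => (Q / ‖k‖) ^ (n + 1) / ((n + 1).factorial : ℝ))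
      (Real.exp (Q / ‖k‖) - 1) := by
    have := NormedSpace.expSeries_div_hasSum_exp (Q / ‖k‖)
    rw [← Real.exp_eq_exp_ℝ] at this
    have := (hasSum_nat_add_iff' 1).mpr this
    simpa using this
  have hb : ‖∑' n : ℕ, ysimp q (n + 1) 0 k‖ ≤ Real.exp (Q / ‖k‖) - 1 :=
    tsum_of_norm_bounded hs (fun n => ysimp_norm_le q hqi k hk hk0 (n + 1))
  have he : ∑' n : ℕ, ysimp q (n + 1) 0 k = -1 := by
    rw [jost] at hzero
    linear_combination hzero
  rw [he, norm_neg, norm_one] at hb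
  have h2 : Real.exp (Q / ‖k‖) < Real.exp ω := Real.exp_lt_exp.mpr ha
  have h3 : 2 < Real.exp ω := by linarith
  have h4 : ω < 1 / 2 := by nlinarith
  have h5 : Real.exp ω < Real.exp (1 / 2) := Real.exp_lt_exp.mpr h4
  have h6 : Real.exp (1 / 2) * Real.exp (1 / 2) = Real.exp 1 := by
    rw [← Real.exp_add]; norm_num
  have h7 := Real.exp_one_lt_d9
  nlinarith
end
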